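/- Setting η = 2∫₀¹ log Γ(x)·sin(2πx) dx, one has ∫₀^{1/2} log Γ(x) dx = (log 2)/4 + πη/8 + (log π)/4 + (1/(2π²))·∑_{n=1}^∞ [1 - (-1)^n]·(log n)/n². -/

import Mathlib

open Real

lemma aux_gauss (n : ℕ) (hn : 0 < n) : ∃ C : ℝ, ∀ x : ℝ, 0 < x →
    ∑ k ∈ Finset.range n, Real.log (Real.Gamma ((x + k) / n))
      = Real.log (Real.Gamma x) - (x - 1) * Real.log n + C := by
  have hn0 : (0:ℝ) < n := by exact_mod_cast hn
  set S : ℝ → ℝ := fun x => ∑ k ∈ Finset.range n, Real.log (Real.Gamma ((x + k) / n)) with hS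
  refine ⟨S 1, fun x hx => ?_⟩
  have key := Real.eq_Gamma_of_log_convex (f := fun x => Real.exp (S x + (x - 1) * Real.log n - S 1))
    ?_ ?_ ?_ ?_ (Set.mem_Ioi.2 hx)
  · simp only at key
    rw [← key, Real.log_exp]
    change S x = _
    ring
  · have h1 : (Real.log ∘ fun x => Real.exp (S x + (x - 1) * Real.log n - S 1))
        = fun x => S x + ((x - 1) * Real.log n - S 1) := by
      ext x; simp; ring
    rw [h1]
    refine ConvexOn.add ?_ ?_
    · have : ∀ m : ℕ, ConvexOn ℝ (Set.Ioi 0) (fun x : ℝ => ∑ k ∈ Finset.range m, Real.log (Real.Gamma ((x + k) / n))) := by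
        intro m
        induction m with
        | zero => simpa using convexOn_const (0:ℝ) (convex_Ioi (0:ℝ))
        | succ m ih =>
          simp only [Finset.sum_range_succ]
          refine ih.add ?_
          refine ⟨convex_Ioi 0, fun a ha b hb s t hs ht hst => ?_⟩
          have ha' : 0 < a := ha
          have hb' : 0 < b := hb
          have := Real.convexOn_log_Gamma.2 (x := (a + m)/n) (y := (b+m)/n)
            (Set.mem_Ioi.2 (by positivity)) (Set.mem_Ioi.2 (by positivity)) hs ht hst
          have e : (s • a + t • b + m) / n = s • ((a + m)/n) + t • ((b+m)/n) := by
            simp only [smul_eq_mul]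
            field_simp
            linear_combination (-(m:ℝ)) * hst
          simp only [Function.comp_apply] at this
          rw [← e] at this; exact this
      exact this n
    · refine ⟨convex_Ioi 0, fun a ha b hb s t hs ht hst => le_of_eq ?_⟩
      simp only [smul_eq_mul]
      linear_combination (Real.log n + S 1) * hst
  · intro y hy
    have h2 : S (y + 1) = S y + Real.log (y / n) := by
      have e1 : S (y + 1) = ∑ k ∈ Finset.range n, Real.log (Real.Gamma ((y + ((k + 1 : ℕ):ℝ)) / n)) := by
        simp only [hS]
        refine Finset.sum_congr rfl fun k _ => ?_
        push_cast; ring_nf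
      have e2 := Finset.sum_range_succ (fun k : ℕ => Real.log (Real.Gamma ((y + k) / n))) n
      have e3 := Finset.sum_range_succ' (fun k : ℕ => Real.log (Real.Gamma ((y + k) / n))) n
      have e4 : (y + n) / n = y / n + 1 := by field_simp
      have hyn : 0 < y / n := by positivity
      rw [e3] at e2
      simp only [e4, Real.Gamma_add_one hyn.ne'] at e2
      rw [Real.log_mul hyn.ne' (Real.Gamma_pos_of_pos hyn).ne', ← e1] at e2
      simp only [Nat.cast_zero, add_zero] at e2
      change _ = S y + _ at e2
      linarith
    rw [h2, Real.log_div hy.ne' hn0.ne']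
    have e5 : S y + (Real.log y - Real.log n) + (y + 1 - 1) * Real.log n - S 1
        = Real.log y + (S y + (y - 1) * Real.log n - S 1) := by ring
    rw [e5, Real.exp_add, Real.exp_log hy]
  · intro y _; positivity
  · simp

lemma aux_int : IntervalIntegrable (fun x => Real.log (Real.Gamma x)) MeasureTheory.volume 0 1 := by
  have h1 : IntervalIntegrable (fun x => Real.log (Real.Gamma (x + 1)) - Real.log x) MeasureTheory.volume 0 1 := by
    refine IntervalIntegrable.sub ?_ intervalIntegral.intervalIntegrable_log'
    apply ContinuousOn.intervalIntegrable
    intro x hx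
    rw [Set.uIcc_of_le zero_le_one] at hx
    have hx0 : 0 < x + 1 := by linarith [hx.1]
    refine ContinuousAt.continuousWithinAt ?_
    refine ContinuousAt.log ?_ (Real.Gamma_pos_of_pos hx0).ne'
    refine ContinuousAt.comp (g := Real.Gamma) (f := fun x : ℝ => x + 1) (x := x) ?_ (by fun_prop)
    have hd : DifferentiableAt ℝ Real.Gamma (x + 1) :=
      Real.differentiableOn_Gamma_Ioi.differentiableAt (Ioi_mem_nhds hx0)
    exact hd.continuousAt
  refine h1.congr ?_
  intro x hx
  rw [Set.uIoc_of_le zero_le_one] at hx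
  simp only
  rw [Real.Gamma_add_one hx.1.ne', Real.log_mul hx.1.ne' (Real.Gamma_pos_of_pos hx.1).ne']
  ring

lemma aux_usin : ∫ u in (0:ℝ)..1, u * Real.sin (2 * π * u) = - 1 / (2 * π) := by
  have hd : ∀ u ∈ Set.uIcc (0:ℝ) 1, HasDerivAt (fun u => Real.sin (2 * π * u) / (2 * π)^2 - u * Real.cos (2 * π * u) / (2 * π))
     (u * Real.sin (2 * π * u)) u := by
    intro u _
    have h0 : HasDerivAt (fun u : ℝ => 2 * π * u) (2 * π) u := by
      simpa using (hasDerivAt_id u).const_mul (2 * π)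
    have h1 := (h0.sin.div_const ((2 * π)^2)).sub (((hasDerivAt_id u).mul h0.cos).div_const (2 * π))
    convert! h1 using 1
    simp only [id]
    field_simp
    ring
  rw [intervalIntegral.integral_eq_sub_of_hasDerivAt hd (by apply Continuous.intervalIntegrable; fun_prop)]
  simp
  ring

lemma aux_sin : ∫ u in (0:ℝ)..1, Real.sin (2 * π * u) = 0 := by
  rw [intervalIntegral.integral_comp_mul_left (fun u => Real.sin u) (by positivity)]
  simp

lemma aux_coef (n : ℕ) (hn : 0 < n) :
    ∫ x in (0:ℝ)..1, Real.log (Real.Gamma x) * Real.sin (2 * π * n * x)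
     = ((∫ x in (0:ℝ)..1, Real.log (Real.Gamma x) * Real.sin (2 * π * x)) + Real.log n / (2 * π)) / n := by
  have hn0 : (0:ℝ) < n := by exact_mod_cast hn
  obtain ⟨C, hC⟩ := aux_gauss n hn
  set g : ℝ → ℝ := fun u => Real.log (Real.Gamma (u / n)) * Real.sin (2 * π * u) with hg
  have hgi : IntervalIntegrable g MeasureTheory.volume 0 n := by
    have h := (aux_int.comp_mul_left (c := (n:ℝ)⁻¹))
    simp only [zero_div, one_div, inv_inv] at h
    have h2 := h.mul_continuousOn (g := fun u => Real.sin (2 * π * u)) (by fun_prop)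
    refine h2.congr fun x _ => ?_
    simp only [hg, div_eq_inv_mul]
  have hk : ∀ k < n, IntervalIntegrable g MeasureTheory.volume ((k:ℕ):ℝ) ((k+1 : ℕ):ℝ) := by
    intro k hk
    refine hgi.mono_set ?_
    rw [Set.uIcc_of_le (by push_cast; linarith), Set.uIcc_of_le hn0.le]
    exact Set.Icc_subset_Icc (Nat.cast_nonneg k) (by exact_mod_cast hk)
  have hgk : ∀ (k : ℕ) (u : ℝ), g (u + k) = Real.log (Real.Gamma ((u + k) / n)) * Real.sin (2 * π * u) := by
    intro k u
    simp only [hg]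
    congr 1
    rw [← Real.sin_add_nat_mul_two_pi (2 * π * u) k]
    congr 1; ring
  have s1 : ∫ x in (0:ℝ)..1, Real.log (Real.Gamma x) * Real.sin (2 * π * n * x)
      = (n:ℝ)⁻¹ * ∫ u in (0:ℝ)..n, g u := by
    have := intervalIntegral.integral_comp_mul_left (a := 0) (b := 1) g hn0.ne'
    simp only [mul_zero, mul_one, smul_eq_mul] at this
    rw [← this]
    refine intervalIntegral.integral_congr fun x _ => ?_
    simp only [hg]
    rw [mul_div_cancel_left₀ _ hn0.ne', mul_assoc (2 * π)]
  have s2 := intervalIntegral.sum_integral_adjacent_intervals (a := fun k : ℕ => (k:ℝ)) hk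
  have s3 : ∀ k : ℕ, ∫ x in (k:ℝ)..((k+1:ℕ):ℝ), g x = ∫ x in (0:ℝ)..1, g (x + k) := by
    intro k
    rw [intervalIntegral.integral_comp_add_right]
    push_cast; simp [add_comm]
  have hgi3 : ∀ k < n, IntervalIntegrable (fun x => g (x + k)) MeasureTheory.volume 0 1 := by
    intro k hkn
    have := (hk k hkn).comp_add_right (k:ℝ)
    simpa using this
  simp only [s3, Nat.cast_zero] at s2
  rw [← intervalIntegral.integral_finsetSum (fun k hk => hgi3 k (Finset.mem_range.1 hk))] at s2
  have s4 : ∫ x in (0:ℝ)..1, ∑ k ∈ Finset.range n, g (x + k)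
     = ∫ x in (0:ℝ)..1, (Real.log (Real.Gamma x) * Real.sin (2 * π * x) - Real.log n * (x * Real.sin (2 * π * x))
        + (C + Real.log n) * Real.sin (2 * π * x)) := by
    refine intervalIntegral.integral_congr_ae (Filter.Eventually.of_forall fun x hx => ?_)
    rw [Set.uIoc_of_le zero_le_one] at hx
    simp only [hgk]
    rw [← Finset.sum_mul, hC x hx.1]
    ring
  have i1 : IntervalIntegrable (fun x => Real.log (Real.Gamma x) * Real.sin (2 * π * x)) MeasureTheory.volume 0 1 :=
    aux_int.mul_continuousOn (by fun_prop)
  rw [s1, ← s2, s4, intervalIntegral.integral_add, intervalIntegral.integral_sub i1,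
    intervalIntegral.integral_const_mul, intervalIntegral.integral_const_mul, aux_usin, aux_sin]
  · field_simp
    ring
  · apply Continuous.intervalIntegrable; fun_prop
  · exact i1.sub (by apply Continuous.intervalIntegrable; fun_prop)
  · apply Continuous.intervalIntegrable; fun_prop

lemma aux_zeta : HasSum (fun n : ℕ => (1 - (-1:ℝ)^n) / (n:ℝ)^2) (π^2/4) := by
  have h1 := hasSum_zeta_two
  have h2 := hasSum_one_div_nat_pow_mul_cos (k := 1) one_ne_zero (x := 1/2) (by constructor <;> norm_num)
  have h3 := h1.sub h2
  convert! h3 using 1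
  · ext n
    rw [show 2 * π * n * (1/2) = n * π by ring, Real.cos_nat_mul_pi]
    ring
  · have : (Polynomial.map (algebraMap ℚ ℝ) (Polynomial.bernoulli (2 * 1))).eval (1/2) = -1/12 := by
      rw [mul_one, Polynomial.bernoulli]
      simp [Finset.sum_range_succ, Polynomial.eval_add, bernoulli_one, bernoulli_eq_bernoulli'_of_ne_one, bernoulli'_two]
      norm_num
    rw [this]
    norm_num [Nat.factorial]
    ring

lemma aux_series (r θ : ℝ) (h0 : 0 ≤ r) (h1 : r < 1) :
    HasSum (fun n : ℕ => (1 - (-1:ℝ)^n) / n * r^n * Real.sin (n * θ))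
      (Complex.arg (1 + r * Complex.exp (θ * Complex.I)) - Complex.arg (1 - r * Complex.exp (θ * Complex.I))) := by
  set z : ℂ := r * Complex.exp (θ * Complex.I) with hz
  have hzn : ‖z‖ < 1 := by
    rw [hz, norm_mul, Complex.norm_exp_ofReal_mul_I]; simpa [abs_of_nonneg h0] using h1
  have h := (Complex.hasSum_taylorSeries_log hzn).add (Complex.hasSum_taylorSeries_neg_log hzn)
  have h' := Complex.hasSum_im h
  convert! h' using 1
  · ext n
    have hp : z ^ n = ((r^n : ℝ) : ℂ) * (Real.cos (n * θ) + Real.sin (n * θ) * Complex.I) := by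
      rw [hz, mul_pow, ← Complex.exp_nat_mul, ← mul_assoc]
      rw [show (n:ℂ) * θ = ((n * θ : ℝ) : ℂ) by push_cast; ring, Complex.exp_mul_I]
      push_cast; ring
    rw [hp]
    have e : (-1:ℂ) ^ (n + 1) * (((r^n : ℝ) : ℂ) * (Real.cos (n * θ) + Real.sin (n * θ) * Complex.I)) / n
      + (((r^n : ℝ) : ℂ) * (Real.cos (n * θ) + Real.sin (n * θ) * Complex.I)) / n
      = (((1 - (-1:ℝ)^n) / n * r^n : ℝ) : ℂ) * (Real.cos (n * θ) + Real.sin (n * θ) * Complex.I) := by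
      push_cast; ring
    rw [e, Complex.im_ofReal_mul]
    simp [-Complex.ofReal_cos, -Complex.ofReal_sin]
  · simp [Complex.log_im]; ring

lemma aux_arg1 (θ : ℝ) (h0 : 0 < θ) (h1 : θ < π) :
    Complex.arg (1 + Complex.exp (θ * Complex.I)) = θ / 2 := by
  have hc : 0 < Real.cos (θ/2) := Real.cos_pos_of_mem_Ioo ⟨by linarith, by linarith⟩
  have e : (1 + Complex.exp (θ * Complex.I)) = ((2 * Real.cos (θ/2) : ℝ):ℂ) * (Complex.cos ((θ/2 : ℝ):ℂ) + Complex.sin ((θ/2 : ℝ):ℂ) * Complex.I) := by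
    have e1 : (θ:ℂ) = 2 * ((θ/2 : ℝ):ℂ) := by push_cast; ring
    rw [Complex.exp_mul_I, e1, Complex.cos_two_mul, Complex.sin_two_mul]
    push_cast; ring
  rw [e]
  exact Complex.arg_mul_cos_add_sin_mul_I (by positivity) ⟨by linarith [pi_pos], by linarith⟩

lemma aux_arg2 (θ : ℝ) (h0 : 0 < θ) (h1 : θ < π) :
    Complex.arg (1 - Complex.exp (θ * Complex.I)) = θ / 2 - π / 2 := by
  have hc : 0 < Real.sin (θ/2) := Real.sin_pos_of_pos_of_lt_pi (by linarith) (by linarith)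
  have e : (1 - Complex.exp (θ * Complex.I)) = ((2 * Real.sin (θ/2) : ℝ):ℂ) * (Complex.cos ((θ/2 - π/2 : ℝ):ℂ) + Complex.sin ((θ/2 - π/2: ℝ):ℂ) * Complex.I) := by
    have e1 : (θ:ℂ) = 2 * ((θ/2 : ℝ):ℂ) := by push_cast; ring
    rw [← Complex.ofReal_cos (θ/2 - π/2), ← Complex.ofReal_sin (θ/2 - π/2), Real.cos_sub_pi_div_two, Real.sin_sub_pi_div_two]
    rw [Complex.exp_mul_I, e1, Complex.cos_two_mul, Complex.sin_two_mul]
    push_cast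
    linear_combination (-2) * (Complex.sin_sq_add_cos_sq ((θ:ℂ)/2))
  rw [e]
  exact Complex.arg_mul_cos_add_sin_mul_I (by positivity) ⟨by linarith [pi_pos], by linarith⟩

lemma aux_lim (θ : ℝ) (hc : |Real.cos θ| < 1) :
    Filter.Tendsto (fun r : ℝ => Complex.arg (1 + r * Complex.exp (θ * Complex.I)) - Complex.arg (1 - r * Complex.exp (θ * Complex.I)))
     (nhdsWithin 1 (Set.Iio 1)) (nhds (Complex.arg (1 + Complex.exp (θ * Complex.I)) - Complex.arg (1 - Complex.exp (θ * Complex.I)))) := by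
  have hc' := abs_lt.1 hc
  refine Filter.Tendsto.mono_left ?_ nhdsWithin_le_nhds
  have c1 : ContinuousAt (fun r : ℝ => Complex.arg (1 + r * Complex.exp (θ * Complex.I)) - Complex.arg (1 - r * Complex.exp (θ * Complex.I))) 1 := by
    refine ContinuousAt.sub ?_ ?_
    · refine ContinuousAt.comp (f := fun r : ℝ => 1 + (r:ℂ) * Complex.exp (θ * Complex.I)) (Complex.continuousAt_arg ?_) (by fun_prop)
      left
      simp [Complex.exp_ofReal_mul_I_re]; linarith
    · refine ContinuousAt.comp (f := fun r : ℝ => 1 - (r:ℂ) * Complex.exp (θ * Complex.I)) (Complex.continuousAt_arg ?_) (by fun_prop)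
      left
      simp [Complex.exp_ofReal_mul_I_re]; linarith
  simpa [ContinuousAt] using c1

lemma aux_lim1 (x : ℝ) (h0 : 0 < x) (h1 : x < 1/2) :
    Filter.Tendsto (fun r : ℝ => Complex.arg (1 + r * Complex.exp ((2 * π * x : ℝ) * Complex.I)) - Complex.arg (1 - r * Complex.exp ((2 * π * x : ℝ) * Complex.I)))
     (nhdsWithin 1 (Set.Iio 1)) (nhds (π/2)) := by
  have hp := pi_pos
  have a0 : 0 < 2 * π * x := by positivity
  have a1 : 2 * π * x < π := by nlinarith
  have hs := Real.sin_pos_of_pos_of_lt_pi a0 a1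
  have h := aux_lim (2 * π * x) (by
    rw [abs_lt]; constructor <;> nlinarith [Real.sin_sq_add_cos_sq (2 * π * x)])
  rw [aux_arg1 _ a0 a1, aux_arg2 _ a0 a1] at h
  convert! h using 2; ring

lemma aux_symm (r x : ℝ) (h0 : 0 ≤ r) (h1 : r < 1) :
    Complex.arg (1 + r * Complex.exp ((2 * π * (1 - x) : ℝ) * Complex.I)) - Complex.arg (1 - r * Complex.exp ((2 * π * (1 - x) : ℝ) * Complex.I))
    = -(Complex.arg (1 + r * Complex.exp ((2 * π * x : ℝ) * Complex.I)) - Complex.arg (1 - r * Complex.exp ((2 * π * x : ℝ) * Complex.I))) := by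
  refine (aux_series r _ h0 h1).unique ?_
  convert! (aux_series r (2 * π * x) h0 h1).neg using 1
  ext n
  rw [show (n:ℝ) * (2 * π * (1 - x)) = n * (2 * π) - n * (2 * π * x) by ring, Real.sin_nat_mul_two_pi_sub]
  ring

lemma aux_lim2 (x : ℝ) (h0 : 1/2 < x) (h1 : x < 1) :
    Filter.Tendsto (fun r : ℝ => Complex.arg (1 + r * Complex.exp ((2 * π * x : ℝ) * Complex.I)) - Complex.arg (1 - r * Complex.exp ((2 * π * x : ℝ) * Complex.I)))
     (nhdsWithin 1 (Set.Iio 1)) (nhds (-(π/2))) := by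
  refine (aux_lim1 (1 - x) (by linarith) (by linarith)).neg.congr' ?_
  have : ∀ᶠ r : ℝ in nhdsWithin 1 (Set.Iio 1), 0 ≤ r := by
    refine Filter.Eventually.filter_mono nhdsWithin_le_nhds ?_
    filter_upwards [lt_mem_nhds (zero_lt_one (α := ℝ))] with r hr using hr.le
  filter_upwards [this, self_mem_nhdsWithin] with r hr hr1
  rw [aux_symm r x hr hr1, neg_neg]

lemma aux_w (n : ℕ) : |1 - (-1:ℝ)^n| ≤ 2 := by
  rcases neg_one_pow_eq_or ℝ n with h | h <;> rw [h] <;> norm_num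

lemma aux_w' (n : ℕ) : |(1 - (-1:ℝ)^n) / n| ≤ 2 := by
  rcases Nat.eq_zero_or_pos n with h | h
  · simp [h]
  · rw [abs_div, Nat.abs_cast]
    have : (1:ℝ) ≤ n := by exact_mod_cast h
    rw [div_le_iff₀ (by positivity)]
    nlinarith [aux_w n]

lemma aux_summ : Summable (fun n : ℕ => (1 - (-1:ℝ)^n) * Real.log n / (n:ℝ)^2) := by
  have h0 : Summable (fun n : ℕ => 4 * (1 / (n:ℝ) ^ (3/2 : ℝ))) :=
    (Real.summable_one_div_nat_rpow.2 (by norm_num)).mul_left 4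
  refine Summable.of_norm_bounded h0 fun n => ?_
  rcases Nat.eq_zero_or_pos n with h | h
  · simp [h]
  · have hn : (1:ℝ) ≤ n := by exact_mod_cast h
    have hn0 : (0:ℝ) < n := by linarith
    have hl := Real.log_le_rpow_div hn0.le (ε := 1/2) (by norm_num)
    have hl0 := Real.log_nonneg hn
    have e : (n:ℝ)^2 = (n:ℝ)^(1/2:ℝ) * (n:ℝ)^(3/2:ℝ) := by
      rw [← Real.rpow_add hn0, ← Real.rpow_natCast]; norm_num
    have p1 : 0 < (n:ℝ)^(1/2:ℝ) := by positivity
    have p2 : 0 < (n:ℝ)^(3/2:ℝ) := by positivity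
    rw [Real.norm_eq_abs, abs_div, abs_mul, abs_of_nonneg hl0, abs_of_nonneg (sq_nonneg (n:ℝ)), e]
    rw [div_le_iff₀ (by positivity)]
    have : 4 * (1 / (n:ℝ)^(3/2:ℝ)) * ((n:ℝ)^(1/2:ℝ) * (n:ℝ)^(3/2:ℝ)) = 4 * (n:ℝ)^(1/2:ℝ) := by
      field_simp
    rw [this]
    have h2 : |1 - (-1:ℝ)^n| * Real.log n ≤ 2 * Real.log n :=
      mul_le_mul_of_nonneg_right (aux_w n) hl0
    have h3 : Real.log n ≤ 2 * (n:ℝ)^(1/2:ℝ) := by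
      refine hl.trans (le_of_eq ?_)
      ring
    linarith

/-- Abel kernel of the square wave. -/
noncomputable def auxP (r x : ℝ) : ℝ :=
  Complex.arg (1 + r * Complex.exp ((2 * π * x : ℝ) * Complex.I))
    - Complex.arg (1 - r * Complex.exp ((2 * π * x : ℝ) * Complex.I))

lemma auxP_meas (r : ℝ) : Measurable (auxP r) := by
  unfold auxP
  refine Measurable.sub (Complex.measurable_arg.comp ?_) (Complex.measurable_arg.comp ?_)
  · exact Continuous.measurable (by fun_prop)
  · exact Continuous.measurable (by fun_prop)

lemma auxP_bound (r x : ℝ) : |auxP r x| ≤ 2 * π := by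
  unfold auxP
  refine (abs_sub _ _).trans ?_
  linarith [Complex.abs_arg_le_pi (1 + r * Complex.exp ((2 * π * x : ℝ) * Complex.I)),
    Complex.abs_arg_le_pi (1 - r * Complex.exp ((2 * π * x : ℝ) * Complex.I))]

lemma aux_swap (r : ℝ) (h0 : 0 ≤ r) (h1 : r < 1) :
    HasSum (fun n : ℕ => (1 - (-1:ℝ)^n) / n * r^n *
        ∫ x in (0:ℝ)..1, Real.log (Real.Gamma x) * Real.sin (2 * π * n * x))
      (∫ x in (0:ℝ)..1, Real.log (Real.Gamma x) * auxP r x) := by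
  have hm : MeasureTheory.AEStronglyMeasurable (fun x => Real.log (Real.Gamma x))
      (MeasureTheory.volume.restrict (Set.uIoc (0:ℝ) 1)) := 
    (intervalIntegrable_iff.1 aux_int).aestronglyMeasurable
  have hsum : ∀ t : ℝ, HasSum (fun n : ℕ => 2 * r^n * |Real.log (Real.Gamma t)|)
      (2 * (1 - r)⁻¹ * |Real.log (Real.Gamma t)|) := fun t =>
    ((hasSum_geometric_of_lt_one h0 h1).mul_left 2).mul_right _
  have key := intervalIntegral.hasSum_integral_of_dominated_convergence
    (μ := MeasureTheory.volume) (a := 0) (b := 1)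
    (F := fun (n : ℕ) (x : ℝ) => (1 - (-1:ℝ)^n) / n * r^n *
      (Real.log (Real.Gamma x) * Real.sin (2 * π * n * x)))
    (f := fun x => Real.log (Real.Gamma x) * auxP r x)
    (fun n t => 2 * r^n * |Real.log (Real.Gamma t)|) ?_ ?_ ?_ ?_ ?_
  · simpa only [intervalIntegral.integral_const_mul] using key
  · intro n
    refine MeasureTheory.AEStronglyMeasurable.const_mul (hm.mul ?_) _
    exact Continuous.aestronglyMeasurable (by fun_prop)
  · intro n
    refine Filter.Eventually.of_forall fun t _ => ?_
    rw [Real.norm_eq_abs, abs_mul, abs_mul, abs_mul, abs_of_nonneg (pow_nonneg h0 n)]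
    have a1 := aux_w' n
    have a2 := Real.abs_sin_le_one (2 * π * n * t)
    have a3 := pow_nonneg h0 n
    gcongr
    exact mul_le_of_le_one_right (abs_nonneg _) a2
  · exact Filter.Eventually.of_forall fun t _ => (hsum t).summable
  · simp only [fun t => (hsum t).tsum_eq]
    exact (aux_int.abs).const_mul _
  · refine Filter.Eventually.of_forall fun t _ => ?_
    convert! (aux_series r (2 * π * t) h0 h1).mul_left (Real.log (Real.Gamma t)) using 1
    ext n
    rw [show 2 * π * n * t = n * (2 * π * t) by ring]
    ring

lemma aux_main (η : ℝ)
    (hη : η = 2 * ∫ x in (0:ℝ)..1, Real.log (Real.Gamma x) * Real.sin (2 * π * x)) :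
    ∫ x in (0:ℝ)..1, Real.log (Real.Gamma x) * (if x < 1/2 then π/2 else -(π/2))
      = η * π^2 / 8 + 1 / (2 * π) * ∑' n : ℕ, (1 - (-1:ℝ)^n) * Real.log n / (n:ℝ)^2 := by
  have hI : ∀ᶠ r : ℝ in nhdsWithin 1 (Set.Iio 1), 0 ≤ r ∧ r < 1 := by
    have : ∀ᶠ r : ℝ in nhdsWithin 1 (Set.Iio 1), 0 ≤ r := by
      refine Filter.Eventually.filter_mono nhdsWithin_le_nhds ?_
      filter_upwards [lt_mem_nhds (zero_lt_one (α := ℝ))] with r hr using hr.le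
    filter_upwards [this, self_mem_nhdsWithin] with r hr hr1 using ⟨hr, hr1⟩
  have hm : MeasureTheory.AEStronglyMeasurable (fun x => Real.log (Real.Gamma x))
      (MeasureTheory.volume.restrict (Set.uIoc (0:ℝ) 1)) := 
    (intervalIntegrable_iff.1 aux_int).aestronglyMeasurable
  have L1 : Filter.Tendsto (fun r : ℝ => ∫ x in (0:ℝ)..1, Real.log (Real.Gamma x) * auxP r x)
      (nhdsWithin 1 (Set.Iio 1))
      (nhds (∫ x in (0:ℝ)..1, Real.log (Real.Gamma x) * (if x < 1/2 then π/2 else -(π/2)))) := by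
    refine intervalIntegral.tendsto_integral_filter_of_dominated_convergence
      (fun x => |Real.log (Real.Gamma x)| * (2 * π)) ?_ ?_ ?_ ?_
    · exact Filter.Eventually.of_forall fun r => hm.mul (auxP_meas r).aestronglyMeasurable
    · refine Filter.Eventually.of_forall fun r => Filter.Eventually.of_forall fun x _ => ?_
      rw [Real.norm_eq_abs, abs_mul]
      exact mul_le_mul_of_nonneg_left (auxP_bound r x) (abs_nonneg _)
    · exact aux_int.abs.mul_const _
    · have e1 : ∀ᵐ x : ℝ, x ≠ 1/2 := MeasureTheory.Measure.ae_ne _ _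
      have e2 : ∀ᵐ x : ℝ, x ≠ 1 := MeasureTheory.Measure.ae_ne _ _
      filter_upwards [e1, e2] with x h1 h2 hx
      rw [Set.uIoc_of_le zero_le_one] at hx
      refine Filter.Tendsto.const_mul _ ?_
      rcases lt_or_gt_of_ne h1 with h | h
      · rw [if_pos h]; exact aux_lim1 x hx.1 h
      · rw [if_neg (not_lt.2 h.le)]; exact aux_lim2 x h (lt_of_le_of_ne hx.2 h2)
  set A : ℕ → ℝ := fun n => η / 2 * ((1 - (-1:ℝ)^n) / (n:ℝ)^2)
    + 1 / (2 * π) * ((1 - (-1:ℝ)^n) * Real.log n / (n:ℝ)^2) with hA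
  have hAs : HasSum A (η / 2 * (π^2/4) + 1 / (2 * π) * ∑' n : ℕ, (1 - (-1:ℝ)^n) * Real.log n / (n:ℝ)^2) :=
    (aux_zeta.mul_left _).add (aux_summ.hasSum.mul_left _)
  have hcoef : ∀ (r : ℝ) (n : ℕ), (1 - (-1:ℝ)^n) / n * r^n *
        ∫ x in (0:ℝ)..1, Real.log (Real.Gamma x) * Real.sin (2 * π * n * x) = r^n * A n := by
    intro r n
    rcases Nat.eq_zero_or_pos n with h | h
    · simp [h, hA]
    · rw [aux_coef n h]
      have : ∫ x in (0:ℝ)..1, Real.log (Real.Gamma x) * Real.sin (2 * π * x) = η / 2 := by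
        rw [hη]; ring
      rw [this]
      have hn0 : (n:ℝ) ≠ 0 := by positivity
      simp only [hA]
      field_simp
  have L2 : Filter.Tendsto (fun r : ℝ => ∑' n : ℕ, r^n * A n)
      (nhdsWithin 1 (Set.Iio 1)) (nhds (∑' n, A n)) := by
    refine tendsto_tsum_of_dominated_convergence hAs.summable.norm ?_ ?_
    · intro k
      refine Filter.Tendsto.mono_left ?_ nhdsWithin_le_nhds
      have : Continuous (fun r : ℝ => r^k * A k) := by fun_prop
      simpa using this.tendsto 1
    · filter_upwards [hI] with r hr k
      rw [norm_mul, norm_pow, Real.norm_of_nonneg hr.1]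
      exact mul_le_of_le_one_left (norm_nonneg _) (pow_le_one₀ hr.1 hr.2.le)
  have L3 := L2.congr' (f₂ := fun r : ℝ => ∫ x in (0:ℝ)..1, Real.log (Real.Gamma x) * auxP r x) (by
    filter_upwards [hI] with r hr
    rw [← (aux_swap r hr.1 hr.2).tsum_eq]
    simp only [hcoef])
  rw [tendsto_nhds_unique L1 L3, hAs.tsum_eq]
  ring

lemma aux_refl : (∫ x in (0:ℝ)..(1/2), Real.log (Real.Gamma x))
    + (∫ x in (1/2:ℝ)..1, Real.log (Real.Gamma x)) = Real.log π / 2 + Real.log 2 / 2 := by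
  have i1 : IntervalIntegrable (fun x => Real.log (Real.Gamma x)) MeasureTheory.volume 0 (1/2) :=
    aux_int.mono_set (by rw [Set.uIcc_of_le (by norm_num), Set.uIcc_of_le (by norm_num)]
                         exact Set.Icc_subset_Icc le_rfl (by norm_num))
  have i2 : IntervalIntegrable (fun x => Real.log (Real.Gamma x)) MeasureTheory.volume (1/2) 1 :=
    aux_int.mono_set (by rw [Set.uIcc_of_le (by norm_num), Set.uIcc_of_le (by norm_num)]
                         exact Set.Icc_subset_Icc (by norm_num) le_rfl)
  have i3 : IntervalIntegrable (fun x => Real.log (Real.Gamma (1 - x))) MeasureTheory.volume 0 (1/2) := by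
    have := (i2.comp_sub_left 1).symm
    norm_num at this
    simpa using this
  have e1 : ∫ x in (1/2:ℝ)..1, Real.log (Real.Gamma x)
      = ∫ x in (0:ℝ)..(1/2), Real.log (Real.Gamma (1 - x)) := by
    rw [intervalIntegral.integral_comp_sub_left (fun x => Real.log (Real.Gamma x))]
    norm_num
  rw [e1, ← intervalIntegral.integral_add i1 i3]
  have e2 : ∫ x in (0:ℝ)..(1/2), (Real.log (Real.Gamma x) + Real.log (Real.Gamma (1 - x)))
      = ∫ x in (0:ℝ)..(1/2), (Real.log π - Real.log (Real.sin (π * x))) := by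
    refine intervalIntegral.integral_congr_ae (Filter.Eventually.of_forall fun x hx => ?_)
    rw [Set.uIoc_of_le (by norm_num)] at hx
    have hs : 0 < Real.sin (π * x) := Real.sin_pos_of_pos_of_lt_pi
      (mul_pos pi_pos hx.1) (by nlinarith [hx.2, pi_pos])
    have g1 := Real.Gamma_pos_of_pos hx.1
    have g2 : 0 < Real.Gamma (1 - x) := Real.Gamma_pos_of_pos (by linarith [hx.2])
    rw [← Real.log_mul g1.ne' g2.ne', Real.Gamma_mul_Gamma_one_sub, Real.log_div pi_ne_zero hs.ne']
  have i4 : IntervalIntegrable (fun x => Real.log (Real.sin (π * x))) MeasureTheory.volume 0 (1/2) := by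
    have := (intervalIntegrable_log_sin (a := 0) (b := π/2)).comp_mul_left (c := π)
    rw [zero_div, show π / 2 / π = 1/2 by field_simp] at this
    exact this
  rw [e2, intervalIntegral.integral_sub (by simp) i4,
    intervalIntegral.integral_comp_mul_left (fun x => Real.log (Real.sin x)) pi_ne_zero,
    mul_zero, show π * (1/2) = π/2 by ring, integral_log_sin_zero_pi_div_two]
  simp only [intervalIntegral.integral_const, smul_eq_mul]
  field_simp
  ring

theorem integral_logGamma_half_eq (η : ℝ)
    (hη : η = 2 * ∫ x in (0:ℝ)..1, Real.log (Real.Gamma x) * Real.sin (2 * π * x)) :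
    ∫ x in (0:ℝ)..(1/2), Real.log (Real.Gamma x)
      = Real.log 2 / 4 + π * η / 8 + Real.log π / 4
        + (1 / (2 * π^2)) *
            ∑' n : ℕ, (1 - (-1:ℝ)^(n + 1)) * Real.log (n + 1) / ((n : ℝ) + 1)^2 := by
  have hm := aux_main η hη
  have hr := aux_refl
  have hs : ∑' n : ℕ, (1 - (-1:ℝ)^n) * Real.log n / (n:ℝ)^2
      = ∑' n : ℕ, (1 - (-1:ℝ)^(n + 1)) * Real.log (n + 1) / ((n : ℝ) + 1)^2 := by
    rw [aux_summ.tsum_eq_zero_add]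
    simp
  rw [hs] at hm
  have sub1 : Set.uIcc (0:ℝ) (1/2) ⊆ Set.uIcc (0:ℝ) 1 := by
    rw [Set.uIcc_of_le (by norm_num), Set.uIcc_of_le (by norm_num)]
    exact Set.Icc_subset_Icc le_rfl (by norm_num)
  have sub2 : Set.uIcc (1/2:ℝ) 1 ⊆ Set.uIcc (0:ℝ) 1 := by
    rw [Set.uIcc_of_le (by norm_num), Set.uIcc_of_le (by norm_num)]
    exact Set.Icc_subset_Icc (by norm_num) le_rfl
  have c1 : ∀ᵐ x : ℝ, x ∈ Set.uIoc (0:ℝ) (1/2) →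
      Real.log (Real.Gamma x) * (π/2) = Real.log (Real.Gamma x) * (if x < 1/2 then π/2 else -(π/2)) := by
    have e1 : ∀ᵐ x : ℝ, x ≠ 1/2 := MeasureTheory.Measure.ae_ne _ _
    filter_upwards [e1] with x h1 hx
    rw [Set.uIoc_of_le (by norm_num)] at hx
    rw [if_pos (lt_of_le_of_ne hx.2 h1)]
  have c2 : ∀ x ∈ Set.uIoc (1/2:ℝ) 1,
      Real.log (Real.Gamma x) * (-(π/2)) = Real.log (Real.Gamma x) * (if x < 1/2 then π/2 else -(π/2)) := by
    intro x hx
    rw [Set.uIoc_of_le (by norm_num)] at hx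
    rw [if_neg (not_lt.2 hx.1.le)]
  have j1 : IntervalIntegrable (fun x => Real.log (Real.Gamma x) * (if x < 1/2 then π/2 else -(π/2)))
      MeasureTheory.volume 0 (1/2) := by
    refine ((aux_int.mono_set sub1).mul_const (π/2)).congr_ae ?_
    rw [Filter.EventuallyEq, MeasureTheory.ae_restrict_iff' measurableSet_uIoc]
    exact c1
  have j2 : IntervalIntegrable (fun x => Real.log (Real.Gamma x) * (if x < 1/2 then π/2 else -(π/2)))
      MeasureTheory.volume (1/2) 1 :=
    ((aux_int.mono_set sub2).mul_const (-(π/2))).congr c2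
  rw [← intervalIntegral.integral_add_adjacent_intervals j1 j2,
    ← intervalIntegral.integral_congr_ae c1,
    ← intervalIntegral.integral_congr_ae (Filter.Eventually.of_forall c2),
    intervalIntegral.integral_mul_const, intervalIntegral.integral_mul_const] at hm
  have hp := pi_pos
  set X := ∫ x in (0:ℝ)..(1/2), Real.log (Real.Gamma x)
  set Y := ∫ x in (1/2:ℝ)..1, Real.log (Real.Gamma x)
  set T := ∑' n : ℕ, (1 - (-1:ℝ)^(n + 1)) * Real.log (n + 1) / ((n : ℝ) + 1)^2
  have hXY : X - Y = η * π / 4 + 1 / π^2 * T := by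
    have : X - Y = (X * (π/2) + Y * (-(π/2))) * (2/π) := by field_simp; ring
    rw [this, hm]; field_simp; ring
  have : 1 / (2 * π^2) * T = (1 / π^2 * T) / 2 := by field_simp
  rw [this]
  linarith
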